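/- arXiv:2403.01951 — 2 statements merged into one kernel-verified Lean document; each statement's English description precedes it below -/
import Mathlib

section
/- Let R be a commutative ring, K a field and φ : R → K a ring homomorphism. Let I be the category whose objects are triples (Y, f, ι) where Y is a reduced scheme, f : Y → Spec R is a proper morphism, and ι : Spec K → Y is a morphism with f ∘ ι = Spec φ and with ι dominant (its image is dense in Y); a morphism (Y, f, ι) → (Y', f', ι') is a scheme morphism g : Y → Y' satisfying f' ∘ g = f and g ∘ ι = ι'. Then: (1) between any two objects of I there exists at most one morphism; and (2) I is cofiltered (in particular nonempty: the spectrum of the image of φ is an object). -/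
open AlgebraicGeometry CategoryTheory

universe u

/-- A *model* of a field `K` over a ring `R` (relative to a ring map `φ : R →+* K`):
a reduced scheme `Y`, proper over `Spec R`, together with a dominant morphism
`Spec K ⟶ Y` factoring `Spec φ`. -/
structure Model (R K : Type u) [CommRing R] [Field K] (φ : R →+* K) where
  /-- The underlying scheme of the model. -/
  Y : Scheme.{u}
  /-- The structure morphism to `Spec R`. -/
  f : Y ⟶ Spec (CommRingCat.of R)
  /-- The morphism from `Spec K`. -/
  ι : Spec (CommRingCat.of K) ⟶ Y
  reduced : IsReduced Y
  proper : IsProper f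
  fac : ι ≫ f = Spec.map (CommRingCat.ofHom φ)
  dom : DenseRange ι.base

variable (R K : Type u) [CommRing R] [Field K] (φ : R →+* K)

/-- Morphisms of models are scheme morphisms over `Spec R` commuting with the maps
from `Spec K`. -/
instance : Category (Model R K φ) where
  Hom A B := { g : A.Y ⟶ B.Y // g ≫ B.f = A.f ∧ A.ι ≫ g = B.ι }
  id A := ⟨𝟙 A.Y, by simp, by simp⟩
  comp {A B C} g h := ⟨g.1 ≫ h.1, by rw [Category.assoc, h.2.1, g.2.1],
    by rw [← Category.assoc, g.2.2, h.2.2]⟩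
  id_comp g := Subtype.ext (Category.id_comp g.1)
  comp_id g := Subtype.ext (Category.comp_id g.1)
  assoc f g h := Subtype.ext (Category.assoc f.1 g.1 h.1)

/-- The scheme-theoretic image of a quasi-compact morphism with reduced source is reduced. -/
lemma AlgebraicGeometry.Scheme.Hom.isReduced_image {X Y : Scheme.{u}} (f : X ⟶ Y)
    [QuasiCompact f] [IsReduced X] : IsReduced f.image := by
  have (U : f.ker.subschemeCover.openCover.I₀) :
      IsReduced (f.ker.subschemeCover.openCover.X U) := by
    change Y.affineOpens at U
    refine (affine_isReduced_iff (.of (Γ(Y, U) ⧸ f.ker.ideal U))).mpr ?_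
    rw [f.ker_apply]
    exact isReduced_of_injective _ (RingHom.kerLift_injective (f.app U).hom)
  exact IsReduced.of_openCover f.image f.ker.subschemeCover.openCover

namespace Model

variable {R K φ}

/-- The scheme-theoretic image of `Spec K` in a proper `R`-scheme, as a model. -/
noncomputable def ofImage {Z : Scheme.{u}} (p : Z ⟶ Spec (CommRingCat.of R)) [IsProper p]
    (j : Spec (CommRingCat.of K) ⟶ Z) (h : j ≫ p = Spec.map (CommRingCat.ofHom φ)) :
    Model R K φ where
  Y := j.image
  f := j.imageι ≫ p
  ι := j.toImage
  reduced :=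
    have : QuasiCompact (j ≫ p) := h ▸ inferInstance
    have : QuasiCompact j := .of_comp j p
    j.isReduced_image
  proper := inferInstance
  fac := by rw [Scheme.Hom.toImage_imageι_assoc, h]
  dom :=
    have : QuasiCompact (j ≫ p) := h ▸ inferInstance
    have : QuasiCompact j := .of_comp j p
    j.toImage.denseRange

lemma subsingleton_hom (A B : Model R K φ) : Subsingleton (A ⟶ B) :=
  ⟨fun g h ↦
    have := A.reduced
    have := B.proper
    have : IsDominant A.ι := ⟨A.dom⟩
    Subtype.ext <| ext_of_isDominant_of_isSeparated B.f (g.2.1.trans h.2.1.symm) A.ι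
      (g.2.2.trans h.2.2.symm)⟩

lemma exists_hom_hom (A B : Model R K φ) : ∃ (C : Model R K φ) (_ : C ⟶ A) (_ : C ⟶ B), True := by
  have := A.proper
  have := B.proper
  let j := Limits.pullback.lift A.ι B.ι (A.fac.trans B.fac.symm)
  have hj : j ≫ Limits.pullback.fst A.f B.f ≫ A.f = Spec.map (CommRingCat.ofHom φ) := by
    rw [Limits.pullback.lift_fst_assoc, A.fac]
  refine ⟨ofImage (Limits.pullback.fst A.f B.f ≫ A.f) j hj,
    ⟨j.imageι ≫ Limits.pullback.fst A.f B.f, Category.assoc _ _ _, ?_⟩,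
    ⟨j.imageι ≫ Limits.pullback.snd A.f B.f, ?_, ?_⟩, trivial⟩
  · exact (j.toImage_imageι_assoc _).trans (Limits.pullback.lift_fst _ _ _)
  · exact (Category.assoc _ _ _).trans (congrArg (j.imageι ≫ ·) Limits.pullback.condition.symm)
  · exact (j.toImage_imageι_assoc _).trans (Limits.pullback.lift_snd _ _ _)

end Model

/-- The category of reduced proper models of `Spec K ⟶ Spec R` has at most one morphism
between any two objects, and it is cofiltered (in particular nonempty). -/
theorem model_category_subsingleton_hom_and_isCofiltered :
    (∀ A B : Model R K φ, Subsingleton (A ⟶ B)) ∧ IsCofiltered (Model R K φ) := by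
  refine ⟨Model.subsingleton_hom, ?_⟩
  exact
    { cone_objs := Model.exists_hom_hom
      cone_maps := fun A B g h ↦ ⟨A, 𝟙 A, by rw [(Model.subsingleton_hom A B).elim g h]⟩
      nonempty := ⟨Model.ofImage (𝟙 _) (Spec.map (CommRingCat.ofHom φ)) (Category.comp_id _)⟩ }
end

section
/- Let R be a commutative ring, K a field and φ : R → K a ring homomorphism. Let I be the category whose objects are triples (Y, f, ι) where Y is a reduced scheme, f : Y → Spec R is a proper morphism, and ι : Spec K → Y is a morphism with f ∘ ι = Spec φ and with ι dominant; morphisms are scheme morphisms over Spec R commuting with the maps from Spec K. Let ZR(K/R) denote the set of valuation subrings V of K with φ(R) ⊆ V, topologized by the basis consisting of finite intersections of the sets {V : a ∈ V} for a ∈ K. For each object (Y, f, ι) of I and each V ∈ ZR(K/R), the valuative criterion of properness yields a unique morphism σ_V : Spec V → Y over Spec R whose restriction along Spec K → Spec V equals ι; let c_Y(V) ∈ Y be the image of the closed point of Spec V under σ_V. Then the map V ↦ (c_Y(V))_{(Y,f,ι)∈I} is a homeomorphism from ZR(K/R) onto the inverse limit lim_{I} |Y| of the underlying topological spaces of the models.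 -/
open AlgebraicGeometry CategoryTheory

universe u

variable (R K : Type u) [CommRing R] [Field K] (φ : R →+* K)

/-- The Zariski–Riemann space of `K` relative to `φ : R →+* K`: the set of valuation
subrings of `K` containing the image of `φ`. -/
def ZR : Type u := { V : ValuationSubring K // ∀ r, φ r ∈ V }

/-- The topology on the Zariski–Riemann space, whose basis consists of finite
intersections of the sets `{V : a ∈ V}` for `a ∈ K`. -/
instance : TopologicalSpace (ZR R K φ) :=
  TopologicalSpace.generateFrom { U : Set (ZR R K φ) | ∃ a : K, U = { V | a ∈ V.1 } }

/-- The inverse limit of the underlying topological spaces of all models, as a subspace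
of the product. -/
def InvLim : Type (u + 1) :=
  { p : (A : Model R K φ) → A.Y //
    ∀ (A B : Model R K φ) (g : A ⟶ B), g.1.base (p A) = p B }

instance : TopologicalSpace (InvLim R K φ) :=
  inferInstanceAs (TopologicalSpace
    { p : (A : Model R K φ) → A.Y //
      ∀ (A B : Model R K φ) (g : A ⟶ B), g.1.base (p A) = p B })

section LocalRange

open IsLocalRing

variable {X Y : Scheme.{u}} {K : Type u} [Field K]

/-- The image in `K` of the local ring of `X` at `x`, for a `K`-valued point `ι` of `X` which
factors through the spectrum of that local ring. -/
def localRange (ι : Spec (CommRingCat.of K) ⟶ X) (x : X) : Set K :=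
  { a | ∃ ψ : X.presheaf.stalk x ⟶ CommRingCat.of K,
    Spec.map ψ ≫ X.fromSpecStalk x = ι ∧ ∃ s, ψ.hom s = a }

lemma exists_stalk_hom (ι : Spec (CommRingCat.of K) ⟶ X) {x : X}
    (h : ι (closedPoint K) ⤳ x) :
    ∃ ψ : X.presheaf.stalk x ⟶ CommRingCat.of K, Spec.map ψ ≫ X.fromSpecStalk x = ι :=
  ⟨X.presheaf.stalkSpecializes h ≫ Scheme.stalkClosedPointTo ι, by
    rw [Spec.map_comp, Category.assoc, Scheme.SpecMap_stalkSpecializes_fromSpecStalk,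
      Scheme.Spec_stalkClosedPointTo_fromSpecStalk]⟩

lemma exists_SpecMap_comp_fromSpec {S : CommRingCat.{u}} [IsLocalRing S] (σ : Spec S ⟶ X)
    {W : X.Opens} (hW : IsAffineOpen W) (h : σ (closedPoint S) ∈ W) :
    ∃ χ : Γ(X, W) ⟶ S, Spec.map χ ≫ hW.fromSpec = σ :=
  ⟨X.presheaf.germ W _ h ≫ Scheme.stalkClosedPointTo σ, by
    rw [Spec.map_comp, Category.assoc]
    exact (congrArg _ (hW.fromSpecStalk_eq_fromSpecStalk h)).trans
      (Scheme.Spec_stalkClosedPointTo_fromSpecStalk σ)⟩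

lemma stalk_hom_unique {S : CommRingCat.{u}} {x : X} {ψ χ : X.presheaf.stalk x ⟶ S}
    (h : Spec.map ψ ≫ X.fromSpecStalk x = Spec.map χ ≫ X.fromSpecStalk x) : ψ = χ :=
  Spec.map_injective ((cancel_mono _).1 h)

lemma mem_localRange_iff {ι : Spec (CommRingCat.of K) ⟶ X} {x : X}
    {ψ : X.presheaf.stalk x ⟶ CommRingCat.of K} (h : Spec.map ψ ≫ X.fromSpecStalk x = ι) {a : K} :
    a ∈ localRange ι x ↔ ∃ s, ψ.hom s = a := by
  constructor
  · rintro ⟨χ, hχ, s, rfl⟩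
    exact ⟨s, by rw [stalk_hom_unique (h.trans hχ.symm)]⟩
  · rintro ⟨s, hs⟩
    exact ⟨ψ, h, s, hs⟩

lemma mem_localRange_Spec {B : CommRingCat.{u}} (θ : B ⟶ CommRingCat.of K) {z : Spec B}
    (h : Spec.map θ (closedPoint K) ⤳ z) (b : B) :
    θ.hom b ∈ localRange (Spec.map θ) z := by
  obtain ⟨ψ, hψ⟩ := exists_stalk_hom _ h
  refine ⟨ψ, hψ, ((Scheme.ΓSpecIso B).inv ≫ (Spec B).presheaf.germ ⊤ z trivial).hom b, ?_⟩
  rw [Spec.fromSpecStalk_eq, ← Spec.map_comp] at hψ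
  rw [← Spec.map_injective hψ]
  rfl

lemma stalk_hom_comp {ι : Spec (CommRingCat.of K) ⟶ X} (g : X ⟶ Y) {x : X}
    {ψ : X.presheaf.stalk x ⟶ CommRingCat.of K} (h : Spec.map ψ ≫ X.fromSpecStalk x = ι) :
    Spec.map (g.stalkMap x ≫ ψ) ≫ Y.fromSpecStalk (g x) = ι ≫ g := by
  rw [Spec.map_comp, Category.assoc, Scheme.SpecMap_stalkMap_fromSpecStalk, ← Category.assoc, h]

lemma localRange_comp_subset (ι : Spec (CommRingCat.of K) ⟶ X) (g : X ⟶ Y) {x : X}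
    (hx : ι (closedPoint K) ⤳ x) : localRange (ι ≫ g) (g x) ⊆ localRange ι x := by
  obtain ⟨ψ, hψ⟩ := exists_stalk_hom _ hx
  intro a ha
  obtain ⟨s, rfl⟩ := (mem_localRange_iff (stalk_hom_comp g hψ)).1 ha
  exact ⟨ψ, hψ, g.stalkMap x s, rfl⟩

lemma localRange_comp_of_isOpenImmersion (ι : Spec (CommRingCat.of K) ⟶ X) (g : X ⟶ Y)
    [IsOpenImmersion g] (x : X) : localRange ι x ⊆ localRange (ι ≫ g) (g x) := by
  rintro _ ⟨ψ, hψ, s, rfl⟩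
  obtain ⟨t, rfl⟩ := ((ConcreteCategory.isIso_iff_bijective (g.stalkMap x)).1 inferInstance).2 s
  exact ⟨_, stalk_hom_comp g hψ, t, rfl⟩

lemma specializes_of_denseRange {ι : Spec (CommRingCat.of K) ⟶ X} (hι : DenseRange ι) (x : X) :
    ι (closedPoint K) ⤳ x := by
  refine specializes_iff_forall_open.2 fun U hU hx ↦ ?_
  obtain ⟨_, hz, q, rfl⟩ := hι.inter_open_nonempty U hU ⟨x, hx⟩
  rwa [← Subsingleton.elim (α := PrimeSpectrum K) q (closedPoint K)]

lemma stalk_hom_germ {ι : Spec (CommRingCat.of K) ⟶ X} {x : X} (hx : ι (closedPoint K) ⤳ x)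
    {ψ : X.presheaf.stalk x ⟶ CommRingCat.of K} (h : Spec.map ψ ≫ X.fromSpecStalk x = ι)
    {U : X.Opens} (hxU : x ∈ U) (s : Γ(X, U)) :
    ψ.hom (X.presheaf.germ U x hxU s) = (Scheme.stalkClosedPointTo ι).hom
      (X.presheaf.germ U _ (hx.mem_open U.2 hxU) s) := by
  have hψ : ψ = X.presheaf.stalkSpecializes hx ≫ Scheme.stalkClosedPointTo ι :=
    stalk_hom_unique (by
      rw [h, Spec.map_comp, Category.assoc, Scheme.SpecMap_stalkSpecializes_fromSpecStalk,
        Scheme.Spec_stalkClosedPointTo_fromSpecStalk])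
  rw [hψ, ← X.presheaf.germ_stalkSpecializes hxU hx]
  rfl

lemma stalk_hom_injective [IsReduced X] {ι : Spec (CommRingCat.of K) ⟶ X} (hι : DenseRange ι)
    {x : X} {ψ : X.presheaf.stalk x ⟶ CommRingCat.of K}
    (h : Spec.map ψ ≫ X.fromSpecStalk x = ι) : Function.Injective ψ.hom := by
  rw [injective_iff_map_eq_zero]
  intro t ht
  obtain ⟨U, hxU, s, rfl⟩ := X.presheaf.exists_germ_eq t
  suffices hs : s = 0 by rw [hs]; exact map_zero _
  rw [← basicOpen_eq_bot_iff, eq_bot_iff]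
  intro y hy
  exfalso
  have hz : ι (closedPoint K) ∈ X.basicOpen s :=
    (specializes_of_denseRange hι y).mem_open (X.basicOpen s).2 hy
  obtain ⟨hzU, hu⟩ := (X.mem_basicOpen'' s _).1 hz
  refine (hu.map (Scheme.stalkClosedPointTo ι).hom).ne_zero ?_
  rw [← ht]
  exact (stalk_hom_germ (specializes_of_denseRange hι x) h hxU s).symm

lemma isOpen_setOf_mem_localRange {ι : Spec (CommRingCat.of K) ⟶ X} (hι : DenseRange ι) (a : K) :
    IsOpen {x | a ∈ localRange ι x} := by
  refine isOpen_iff_forall_mem_open.2 ?_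
  rintro x ⟨ψ, hψ, t, rfl⟩
  obtain ⟨U, hxU, s, rfl⟩ := X.presheaf.exists_germ_eq t
  refine ⟨U, fun y hy ↦ ?_, U.2, hxU⟩
  have hx := specializes_of_denseRange hι x
  have hy' := specializes_of_denseRange hι y
  obtain ⟨χ, hχ⟩ := exists_stalk_hom ι hy'
  exact ⟨χ, hχ, X.presheaf.germ U y hy s,
    (stalk_hom_germ hy' hχ hy s).trans (stalk_hom_germ hx hψ hxU s).symm⟩

lemma exists_subring_coe_eq_localRange (ι : Spec (CommRingCat.of K) ⟶ X) {x : X}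
    (h : ι (closedPoint K) ⤳ x) : ∃ S : Subring K, (S : Set K) = localRange ι x := by
  obtain ⟨ψ, hψ⟩ := exists_stalk_hom ι h
  exact ⟨ψ.hom.range, Set.ext fun a ↦ (mem_localRange_iff hψ).symm⟩

lemma inv_mem_localRange_comp [IsReduced X] {ι : Spec (CommRingCat.of K) ⟶ X}
    (hι : DenseRange ι) (g : X ⟶ Y) {x : X} (hx : ι (closedPoint K) ⤳ x) {a : K} (h0 : a ≠ 0)
    (ha : a ∈ localRange (ι ≫ g) (g x)) (ha' : a⁻¹ ∈ localRange ι x) :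
    a⁻¹ ∈ localRange (ι ≫ g) (g x) := by
  obtain ⟨ψ, hψ⟩ := exists_stalk_hom _ hx
  obtain ⟨s, hs⟩ := (mem_localRange_iff (stalk_hom_comp g hψ)).1 ha
  obtain ⟨t, ht⟩ := (mem_localRange_iff hψ).1 ha'
  have hs' : ψ.hom ((g.stalkMap x).hom s) = a := hs
  have hst : (g.stalkMap x).hom s * t = 1 := stalk_hom_injective hι hψ (by
    rw [map_mul, hs', ht, map_one, mul_inv_cancel₀ h0])
  obtain ⟨u, rfl⟩ := isUnit_of_map_unit (g.stalkMap x).hom s (IsUnit.of_mul_eq_one _ hst)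
  refine (mem_localRange_iff (stalk_hom_comp g hψ)).2 ⟨↑u⁻¹, ?_⟩
  refine eq_inv_of_mul_eq_one_left ?_
  rw [← hs, ← map_mul, Units.inv_mul, map_one]

variable (V : ValuationSubring K)

lemma localRange_closedPoint {σ : Spec (CommRingCat.of V) ⟶ X}
    {ι : Spec (CommRingCat.of K) ⟶ X}
    (h : Spec.map (CommRingCat.ofHom V.subtype) ≫ σ = ι) {a : K}
    (ha : a ∈ localRange ι (σ (closedPoint V))) :
    a ∈ V ∧ (a ≠ 0 → a⁻¹ ∈ V → a⁻¹ ∈ localRange ι (σ (closedPoint V))) := by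
  have hψ : Spec.map (Scheme.stalkClosedPointTo σ ≫ CommRingCat.ofHom V.subtype) ≫
      X.fromSpecStalk _ = ι := by
    rw [Spec.map_comp, Category.assoc, Scheme.Spec_stalkClosedPointTo_fromSpecStalk, h]
  obtain ⟨s, rfl⟩ := (mem_localRange_iff hψ).1 ha
  refine ⟨((Scheme.stalkClosedPointTo σ).hom s).2, fun h0 hinv ↦ ?_⟩
  have hu : IsUnit ((Scheme.stalkClosedPointTo σ).hom s) :=
    IsUnit.of_mul_eq_one ⟨_, hinv⟩ (Subtype.ext (mul_inv_cancel₀ h0))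
  obtain ⟨u, rfl⟩ := isUnit_of_map_unit _ s hu
  refine (mem_localRange_iff hψ).2 ⟨↑u⁻¹, ?_⟩
  refine eq_inv_of_mul_eq_one_left ?_
  rw [← map_mul, Units.inv_mul, map_one]

lemma exists_lift_of_localRange [IsReduced X] {ι : Spec (CommRingCat.of K) ⟶ X}
    (hι : DenseRange ι) {x : X} (hx : ι (closedPoint K) ⤳ x)
    (hV : ∀ a ∈ localRange ι x, a ∈ V ∧ (a ≠ 0 → a⁻¹ ∈ V → a⁻¹ ∈ localRange ι x)) :
    ∃ σ : Spec (CommRingCat.of V) ⟶ X,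
      Spec.map (CommRingCat.ofHom V.subtype) ≫ σ = ι ∧ σ (closedPoint V) = x := by
  obtain ⟨ψ, hψ⟩ := exists_stalk_hom _ hx
  let χ : X.presheaf.stalk x ⟶ CommRingCat.of V :=
    CommRingCat.ofHom (ψ.hom.codRestrict V.toSubring fun s ↦ (hV _ ⟨ψ, hψ, s, rfl⟩).1)
  have hχ : χ ≫ CommRingCat.ofHom V.subtype = ψ := rfl
  have : IsLocalHom χ.hom := ⟨fun s hs ↦ by
    obtain ⟨u, hu⟩ := hs
    have h1 : ψ.hom s * (↑u⁻¹ : V) = 1 := by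
      have : (u : V) * (↑u⁻¹ : V) = 1 := Units.mul_inv u
      rw [hu] at this
      exact congrArg Subtype.val this
    have h0 : ψ.hom s ≠ 0 := left_ne_zero_of_mul_eq_one h1
    have h2 : (ψ.hom s)⁻¹ = (↑u⁻¹ : V) := inv_eq_of_mul_eq_one_right h1
    obtain ⟨t, ht⟩ := (mem_localRange_iff hψ).1
      ((hV _ ⟨ψ, hψ, s, rfl⟩).2 h0 (h2 ▸ (↑u⁻¹ : V).2))
    exact IsUnit.of_mul_eq_one t (stalk_hom_injective hι hψ (by
      rw [map_mul, ht, map_one, mul_inv_cancel₀ h0]))⟩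
  refine ⟨Spec.map χ ≫ X.fromSpecStalk x, ?_, ?_⟩
  · rw [← Category.assoc, ← Spec.map_comp, hχ, hψ]
  · exact (congrArg (X.fromSpecStalk x) (Spec_closedPoint (f := χ))).trans
      Scheme.fromSpecStalk_closedPoint

end LocalRange

variable {R K φ}

namespace Model

instance isSchemeTheoreticallyDominant_toImage {X Y : Scheme.{u}} (g : X ⟶ Y) [QuasiCompact g] :
    IsSchemeTheoreticallyDominant g.toImage := by
  rw [isSchemeTheoreticallyDominant_iff]
  refine Scheme.IdealSheafData.ext_of_iSup_eq_top
    (fun U : Y.affineOpens ↦ ⟨g.imageι ⁻¹ᵁ U.1, U.2.preimage g.imageι⟩) ?_ fun U ↦ ?_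
  · rw [← Scheme.Hom.preimage_iSup, iSup_affineOpens_eq_top Y, Scheme.Hom.preimage_top]
  · rw [Scheme.Hom.ker_apply, Scheme.IdealSheafData.ideal_bot, Pi.bot_apply,
      ← RingHom.injective_iff_ker_eq_bot]
    exact g.toImage_app_injective U

/-- The closure of the image of a `K`-valued point in a proper `R`-scheme is a model. -/
lemma exists_hom_of_isProper {X : Scheme.{u}} (f : X ⟶ Spec (CommRingCat.of R)) [IsProper f]
    (ι : Spec (CommRingCat.of K) ⟶ X) (h : ι ≫ f = Spec.map (CommRingCat.ofHom φ)) :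
    ∃ (A : Model R K φ) (j : A.Y ⟶ X), j ≫ f = A.f ∧ A.ι ≫ j = ι := by
  have : QuasiCompact (ι ≫ f) := by rw [h]; infer_instance
  have : QuasiCompact ι := .of_comp ι f
  have : IsReduced ι.image := IsSchemeTheoreticallyDominant.isReduced ι.toImage
  exact ⟨⟨ι.image, ι.imageι ≫ f, ι.toImage, this, inferInstance,
    by rw [ι.toImage_imageι_assoc, h], ι.toImage.denseRange⟩, ι.imageι, rfl, ι.toImage_imageι⟩

lemma exists_hom_pair (A B : Model R K φ) :
    ∃ C : Model R K φ, Nonempty (C ⟶ A) ∧ Nonempty (C ⟶ B) := by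
  have := A.proper
  have := B.proper
  obtain ⟨C, j, hj, hι⟩ := exists_hom_of_isProper (φ := φ)
    (Limits.pullback.fst A.f B.f ≫ A.f)
    (Limits.pullback.lift A.ι B.ι (A.fac.trans B.fac.symm))
    (by rw [Limits.pullback.lift_fst_assoc, A.fac])
  refine ⟨C, ⟨⟨j ≫ Limits.pullback.fst _ _, by rw [← hj, Category.assoc], ?_⟩⟩,
    ⟨⟨j ≫ Limits.pullback.snd _ _, by rw [← hj, Limits.pullback.condition, Category.assoc], ?_⟩⟩⟩
  · rw [← Category.assoc, hι, Limits.pullback.lift_fst]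
  · rw [← Category.assoc, hι, Limits.pullback.lift_snd]

end Model

section ProjectiveLine

open MvPolynomial HomogeneousLocalization

variable (R)

/-- The standard grading on the polynomial ring in two variables. -/
local notation "𝒮" => homogeneousSubmodule (Fin 2) R

attribute [local instance] MvPolynomial.gradedAlgebra

instance : IsScalarTower R (𝒮 0) (MvPolynomial (Fin 2) R) :=
  ⟨fun r x p ↦ smul_mul_assoc r (x : MvPolynomial (Fin 2) R) p⟩

instance : Algebra.FiniteType (𝒮 0) (MvPolynomial (Fin 2) R) :=
  .of_restrictScalars_finiteType R _ _

lemma algebraMap_homogeneousSubmodule_zero_bijective :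
    Function.Bijective (algebraMap R (𝒮 0)) := by
  constructor
  · intro a b h
    exact C_injective (Fin 2) R (congrArg Subtype.val h)
  · rintro ⟨p, hp⟩
    have : p ∈ 𝒮 0 := hp
    rw [homogeneousSubmodule_zero, Submodule.mem_one] at this
    obtain ⟨r, rfl⟩ := this
    exact ⟨r, rfl⟩

/-- The structure morphism of the projective line over `R`. -/
noncomputable def projectiveLineStr : Proj 𝒮 ⟶ Spec (CommRingCat.of R) :=
  Proj.toSpecZero 𝒮 ≫ Spec.map (CommRingCat.ofHom (algebraMap R (𝒮 0)))

instance : IsProper (projectiveLineStr R) := by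
  have : IsIso (CommRingCat.ofHom (algebraMap R (𝒮 0))) :=
    (ConcreteCategory.isIso_iff_bijective _).2 (algebraMap_homogeneousSubmodule_zero_bijective R)
  unfold projectiveLineStr
  infer_instance

lemma X_mem_homogeneousSubmodule (i : Fin 2) : (X i : MvPolynomial (Fin 2) R) ∈ 𝒮 1 :=
  isHomogeneous_X R i

variable {R}

/-- Evaluation of degree-zero fractions at a point `x` of `K²` where the denominator does not
vanish. -/
noncomputable def awayEval (φ : R →+* K) (x : Fin 2 → K) (f : MvPolynomial (Fin 2) R)
    (hf : eval₂ φ x f ≠ 0) : Away 𝒮 f →+* K :=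
  (IsLocalization.Away.lift (S := Localization.Away f) f (g := eval₂Hom φ x)
    (isUnit_iff_ne_zero.2 hf)).comp (algebraMap (Away 𝒮 f) (Localization.Away f))

lemma awayEval_mk (φ : R →+* K) (x : Fin 2 → K) (f : MvPolynomial (Fin 2) R)
    (hf : eval₂ φ x f ≠ 0) {d : ℕ} (hd : f ∈ 𝒮 d) (n : ℕ) (p : MvPolynomial (Fin 2) R)
    (hp : p ∈ 𝒮 (n • d)) :
    awayEval φ x f hf (Away.mk 𝒮 hd n p hp) = eval₂ φ x p / eval₂ φ x f ^ n := by
  rw [awayEval, RingHom.comp_apply, HomogeneousLocalization.algebraMap_apply, Away.val_mk,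
    Localization.mk_eq_mk', IsLocalization.Away.lift, IsLocalization.lift_mk'_spec]
  change eval₂ φ x p = eval₂Hom φ x (f ^ n) * _
  rw [map_pow]
  exact (mul_div_cancel₀ _ (pow_ne_zero n hf)).symm

lemma awayEval_comp_awayMap (φ : R →+* K) (x : Fin 2 → K) (f g h : MvPolynomial (Fin 2) R)
    (hf : eval₂ φ x f ≠ 0) (hg : eval₂ φ x g ≠ 0) (hh : eval₂ φ x h ≠ 0) {d e : ℕ}
    (hd : f ∈ 𝒮 d) (he : g ∈ 𝒮 e) (H : h = f * g) :
    (awayEval φ x h hh).comp (awayMap 𝒮 he H) = awayEval φ x f hf := by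
  ext z
  obtain ⟨n, p, hp, rfl⟩ := Away.mk_surjective 𝒮 hd z
  rw [RingHom.comp_apply, awayMap_mk, awayEval_mk, awayEval_mk, H, eval₂_mul, eval₂_mul,
    eval₂_pow, mul_pow, mul_div_mul_right _ _ (pow_ne_zero n hg)]

lemma awayEval_comp_fromZeroRingHom (φ : R →+* K) (x : Fin 2 → K) (f : MvPolynomial (Fin 2) R)
    (hf : eval₂ φ x f ≠ 0) (r : R) :
    awayEval φ x f hf (fromZeroRingHom 𝒮 _ (algebraMap R (𝒮 0) r)) = φ r := by
  change IsLocalization.Away.lift (S := Localization.Away f) f (g := eval₂Hom φ x)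
    (isUnit_iff_ne_zero.2 hf) (Localization.mk (C r) 1) = φ r
  rw [Localization.mk_one_eq_algebraMap, IsLocalization.Away.lift_eq]
  exact eval₂_C φ x r

lemma SpecMap_awayEval_awayι (φ : R →+* K) (x : Fin 2 → K) (f g h : MvPolynomial (Fin 2) R)
    (hf : eval₂ φ x f ≠ 0) (hg : eval₂ φ x g ≠ 0) (hh : eval₂ φ x h ≠ 0) {d e : ℕ}
    (hd : f ∈ 𝒮 d) (he : g ∈ 𝒮 e) (hfd : 0 < d) (H : h = f * g) :
    Spec.map (CommRingCat.ofHom (awayEval φ x f hf)) ≫ Proj.awayι 𝒮 f hd hfd =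
      Spec.map (CommRingCat.ofHom (awayEval φ x h hh)) ≫
        Proj.awayι 𝒮 h (H ▸ SetLike.mul_mem_graded hd he) (hfd.trans_le (d.le_add_right e)) := by
  rw [← awayEval_comp_awayMap φ x f g h hf hg hh hd he H, CommRingCat.ofHom_comp, Spec.map_comp,
    Category.assoc, Proj.SpecMap_awayMap_awayι]

lemma iSup_basicOpen_X : ⨆ i, Proj.basicOpen 𝒮 (X i) = ⊤ := by
  refine Proj.iSup_basicOpen_eq_top' 𝒮 _ (fun i ↦ ⟨1, isHomogeneous_X R i⟩) ?_
  refine eq_top_iff.2 fun p _ ↦ ?_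
  have hp : p ∈ Algebra.adjoin R (Set.range (X : Fin 2 → MvPolynomial (Fin 2) R)) := by
    rw [adjoin_range_X]; trivial
  have hle : Algebra.adjoin R (Set.range (X : Fin 2 → MvPolynomial (Fin 2) R)) ≤
      (Algebra.adjoin (𝒮 0) (Set.range X)).restrictScalars R :=
    Algebra.adjoin_le Algebra.subset_adjoin
  exact hle hp

lemma div_mem_localRange {Y : Scheme.{u}} {ι : Spec (CommRingCat.of K) ⟶ Y}
    (hι : DenseRange ι) (j : Y ⟶ Proj 𝒮) (x : Fin 2 → K) {i : Fin 2}
    (hi : eval₂ φ x (X i) ≠ 0)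
    (h : ι ≫ j = Spec.map (CommRingCat.ofHom (awayEval φ x (X i) hi)) ≫
      Proj.awayι 𝒮 (X i) (X_mem_homogeneousSubmodule R i) one_pos)
    {y : Y} (hy : j y ∈ Proj.basicOpen 𝒮 (X i)) (k : Fin 2) :
    x k / x i ∈ localRange ι y := by
  have hιy := specializes_of_denseRange hι y
  rw [← Proj.opensRange_awayι 𝒮 (X i) (X_mem_homogeneousSubmodule R i) one_pos] at hy
  obtain ⟨z, hz⟩ := hy
  refine localRange_comp_subset ι j hιy ?_
  rw [h, ← hz]
  have : IsOpenImmersion (Proj.awayι 𝒮 (X i) (X_mem_homogeneousSubmodule R i) one_pos) :=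
    inferInstance
  refine localRange_comp_of_isOpenImmersion _
    (Proj.awayι 𝒮 (X i) (X_mem_homogeneousSubmodule R i) one_pos) z ?_
  have hs : (Spec.map (CommRingCat.ofHom (awayEval φ x (X i) hi)))
      (IsLocalRing.closedPoint K) ⤳ z := by
    have hpt : Proj.awayι 𝒮 (X i) (X_mem_homogeneousSubmodule R i) one_pos
        (Spec.map (CommRingCat.ofHom (awayEval φ x (X i) hi)) (IsLocalRing.closedPoint K)) =
        j (ι (IsLocalRing.closedPoint K)) :=
      congrArg (fun g : Spec (CommRingCat.of K) ⟶ Proj 𝒮 ↦ g (IsLocalRing.closedPoint K)) h.symm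
    rw [← (Proj.awayι 𝒮 (X i) (X_mem_homogeneousSubmodule R i)
      one_pos).isOpenEmbedding.isInducing.specializes_iff, hz, hpt]
    exact hιy.map j.continuous
  have := mem_localRange_Spec _ hs
    (Away.mk 𝒮 (X_mem_homogeneousSubmodule R i) 1 (X k) (X_mem_homogeneousSubmodule R k))
  rw [CommRingCat.hom_ofHom, awayEval_mk, eval₂_X, eval₂_X, pow_one] at this
  exact this

/-- For nonzero `a` there is a model all of whose local rings contain `a` or `a⁻¹`. -/
lemma Model.exists_mem_or_inv_mem {a : K} (ha : a ≠ 0) :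
    ∃ A : Model R K φ, ∀ y : A.Y, a ∈ localRange A.ι y ∨ a⁻¹ ∈ localRange A.ι y := by
  have h0 : eval₂ φ ![1, a] (X 0) ≠ 0 := by simp
  have h1 : eval₂ φ ![1, a] (X 1) ≠ 0 := by simpa
  have h01 : eval₂ φ ![1, a] (X 0 * X 1) ≠ 0 := by simpa
  have hd : (X 0 * X 1 : MvPolynomial (Fin 2) R) ∈ 𝒮 (1 + 1) :=
    SetLike.mul_mem_graded (X_mem_homogeneousSubmodule R 0) (X_mem_homogeneousSubmodule R 1)
  let ι := Spec.map (CommRingCat.ofHom (awayEval φ ![1, a] (X 0 * X 1) h01)) ≫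
    Proj.awayι 𝒮 _ hd two_pos
  obtain ⟨A, j, hj, hι⟩ := Model.exists_hom_of_isProper (φ := φ) (projectiveLineStr R) ι (by
    rw [projectiveLineStr, Category.assoc, Proj.awayι_toSpecZero_assoc, ← Spec.map_comp,
      ← Spec.map_comp]
    congr 1
    ext r
    exact awayEval_comp_fromZeroRingHom φ _ _ h01 r)
  refine ⟨A, fun y ↦ ?_⟩
  have hy : j y ∈ ⨆ i, Proj.basicOpen 𝒮 (X i) := by rw [iSup_basicOpen_X]; trivial
  obtain ⟨i, hi⟩ := TopologicalSpace.Opens.mem_iSup.1 hy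
  fin_cases i
  · left
    simpa using div_mem_localRange (φ := φ) A.dom j ![1, a] h0 (hι.trans
      (SpecMap_awayEval_awayι φ _ _ _ _ h0 h1 h01
        (X_mem_homogeneousSubmodule R 0) (X_mem_homogeneousSubmodule R 1)
        one_pos rfl).symm) hi 1
  · right
    simpa using div_mem_localRange (φ := φ) A.dom j ![1, a] h1 (hι.trans
      (SpecMap_awayEval_awayι φ _ _ _ _ h1 h0 h01
        (X_mem_homogeneousSubmodule R 1) (X_mem_homogeneousSubmodule R 0)
        one_pos (mul_comm _ _)).symm) hi 0

end ProjectiveLine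

section InverseLimit

open IsLocalRing

namespace InvLim

variable (p : InvLim R K φ)

lemma localRange_eq {A B : Model R K φ} (g : A ⟶ B) :
    localRange B.ι (p.1 B) = localRange (A.ι ≫ g.1) (g.1 (p.1 A)) :=
  congrArg₂ localRange g.2.2.symm (p.2 A B g).symm

lemma localRange_subset {A B : Model R K φ} (g : A ⟶ B) :
    localRange B.ι (p.1 B) ⊆ localRange A.ι (p.1 A) := by
  rw [p.localRange_eq g]
  exact localRange_comp_subset _ _ (specializes_of_denseRange A.dom _)

lemma exists_mem_localRange_pair {a b : K} (ha : ∃ A : Model R K φ, a ∈ localRange A.ι (p.1 A))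
    (hb : ∃ A : Model R K φ, b ∈ localRange A.ι (p.1 A)) :
    ∃ (A : Model R K φ) (S : Subring K), (S : Set K) = localRange A.ι (p.1 A) ∧
      a ∈ S ∧ b ∈ S := by
  obtain ⟨A, ha⟩ := ha
  obtain ⟨B, hb⟩ := hb
  obtain ⟨C, ⟨g⟩, ⟨h⟩⟩ := Model.exists_hom_pair A B
  obtain ⟨S, hS⟩ := exists_subring_coe_eq_localRange C.ι (specializes_of_denseRange C.dom (p.1 C))
  refine ⟨C, S, hS, ?_, ?_⟩
  · rw [← SetLike.mem_coe, hS]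
    exact p.localRange_subset g ha
  · rw [← SetLike.mem_coe, hS]
    exact p.localRange_subset h hb

lemma exists_map_mem_localRange (r : R) :
    ∃ A : Model R K φ, φ r ∈ localRange A.ι (p.1 A) := by
  obtain ⟨A, -⟩ := Model.exists_mem_or_inv_mem (φ := φ) (one_ne_zero (α := K))
  have h := specializes_of_denseRange A.dom (p.1 A)
  refine ⟨A, localRange_comp_subset A.ι A.f h ?_⟩
  have h' := h.map A.f.continuous
  have hpt : A.f (A.ι (closedPoint K)) = Spec.map (CommRingCat.ofHom φ) (closedPoint K) :=
    congrArg (fun g : Spec (CommRingCat.of K) ⟶ Spec (CommRingCat.of R) ↦ g (closedPoint K)) A.fac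
  rw [hpt] at h'
  rw [A.fac]
  exact mem_localRange_Spec _ h' r

/-- The union of the local rings at a compatible system of points, as a valuation ring. -/
def toValuationSubring : ValuationSubring K where
  carrier := {a | ∃ A : Model R K φ, a ∈ localRange A.ι (p.1 A)}
  mul_mem' ha hb := by
    obtain ⟨A, S, hS, ha, hb⟩ := p.exists_mem_localRange_pair ha hb
    exact ⟨A, hS ▸ S.mul_mem ha hb⟩
  add_mem' ha hb := by
    obtain ⟨A, S, hS, ha, hb⟩ := p.exists_mem_localRange_pair ha hb
    exact ⟨A, hS ▸ S.add_mem ha hb⟩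
  neg_mem' ha := by
    obtain ⟨A, S, hS, ha, -⟩ := p.exists_mem_localRange_pair ha ha
    exact ⟨A, hS ▸ S.neg_mem ha⟩
  one_mem' := by simpa using p.exists_map_mem_localRange 1
  zero_mem' := by simpa using p.exists_map_mem_localRange 0
  mem_or_inv_mem' a := by
    rcases eq_or_ne a 0 with rfl | ha
    · left
      simpa using p.exists_map_mem_localRange 0
    · obtain ⟨A, hA⟩ := Model.exists_mem_or_inv_mem (φ := φ) ha
      exact (hA (p.1 A)).imp (fun h ↦ ⟨A, h⟩) fun h ↦ ⟨A, h⟩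

lemma mem_toValuationSubring {a : K} :
    a ∈ p.toValuationSubring ↔ ∃ A : Model R K φ, a ∈ localRange A.ι (p.1 A) :=
  Iff.rfl

/-- The point of the Zariski–Riemann space defined by a compatible system of points. -/
def toZR : ZR R K φ := ⟨p.toValuationSubring, p.exists_map_mem_localRange⟩

lemma continuous_toZR : Continuous (toZR : InvLim R K φ → ZR R K φ) := by
  refine continuous_generateFrom_iff.2 ?_
  rintro _ ⟨a, rfl⟩
  have : toZR ⁻¹' {V : ZR R K φ | a ∈ V.1} =
      ⋃ A : Model R K φ, (fun p : InvLim R K φ ↦ p.1 A) ⁻¹' {x | a ∈ localRange A.ι x} := by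
    ext p
    simp only [Set.mem_preimage, Set.mem_ofPred_eq, Set.mem_iUnion]
    exact p.mem_toValuationSubring
  rw [this]
  exact isOpen_iUnion fun A ↦ (isOpen_setOf_mem_localRange A.dom a).preimage
    ((continuous_apply A).comp continuous_subtype_val)

lemma exists_lift (A : Model R K φ) :
    ∃ σ : Spec (CommRingCat.of p.toZR.1) ⟶ A.Y,
      Spec.map (CommRingCat.ofHom p.toZR.1.subtype) ≫ σ = A.ι ∧
        σ (closedPoint p.toZR.1) = p.1 A := by
  have := A.reduced
  refine exists_lift_of_localRange _ A.dom (specializes_of_denseRange A.dom _)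
    fun a ha ↦ ⟨⟨A, ha⟩, fun h0 ⟨B, hB⟩ ↦ ?_⟩
  obtain ⟨C, ⟨g⟩, ⟨h⟩⟩ := Model.exists_hom_pair A B
  have := C.reduced
  rw [p.localRange_eq g] at ha ⊢
  exact inv_mem_localRange_comp C.dom g.1 (specializes_of_denseRange C.dom _) h0 ha
    (p.localRange_subset h hB)

end InvLim

namespace ZR

variable (V : ZR R K φ) (A : Model R K φ)

lemma comp_f_of_comp_eq {σ : Spec (CommRingCat.of V.1) ⟶ A.Y}
    (h : Spec.map (CommRingCat.ofHom V.1.subtype) ≫ σ = A.ι) :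
    σ ≫ A.f = Spec.map (CommRingCat.ofHom (φ.codRestrict V.1.toSubring V.2)) := by
  obtain ⟨θ, hθ⟩ := Spec.map_surjective (σ ≫ A.f)
  have : θ ≫ CommRingCat.ofHom V.1.subtype = CommRingCat.ofHom φ := Spec.map_injective (by
    rw [Spec.map_comp, hθ, ← Category.assoc, h, A.fac])
  rw [← hθ]
  congr 1
  ext r
  exact congrArg (fun f : CommRingCat.of R ⟶ CommRingCat.of K ↦ f.hom r) this

lemma existsUnique_lift : ∃! σ : Spec (CommRingCat.of V.1) ⟶ A.Y,
    Spec.map (CommRingCat.ofHom V.1.subtype) ≫ σ = A.ι := by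
  have hcomm : CommSq A.ι (Spec.map (CommRingCat.ofHom (algebraMap V.1 K))) A.f
      (Spec.map (CommRingCat.ofHom (φ.codRestrict V.1.toSubring V.2))) :=
    ⟨by rw [A.fac, ← Spec.map_comp]; rfl⟩
  have hA := A.proper
  rw [IsProper.eq_valuativeCriterion] at hA
  obtain ⟨⟨l⟩, hl⟩ := (hA.1.1.1 ⟨V.1, K, A.ι, _, hcomm⟩).some
  refine ⟨l.l, l.fac_left, fun σ hσ ↦ ?_⟩
  exact congrArg CommSq.LiftStruct.l (hl ⟨σ, hσ, V.comp_f_of_comp_eq A hσ⟩)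

/-- The morphism `Spec V ⟶ Y` provided by the valuative criterion of properness. -/
noncomputable def lift : Spec (CommRingCat.of V.1) ⟶ A.Y :=
  (V.existsUnique_lift A).choose

lemma comp_lift : Spec.map (CommRingCat.ofHom V.1.subtype) ≫ V.lift A = A.ι :=
  (V.existsUnique_lift A).choose_spec.1

variable {V A} in
lemma eq_lift {σ : Spec (CommRingCat.of V.1) ⟶ A.Y}
    (h : Spec.map (CommRingCat.ofHom V.1.subtype) ≫ σ = A.ι) : σ = V.lift A :=
  (V.existsUnique_lift A).choose_spec.2 σ h

/-- The family of centers of `V` on the models. -/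
noncomputable def center : InvLim R K φ :=
  ⟨fun A ↦ V.lift A (closedPoint V.1), fun A B g ↦ by
    have : V.lift A ≫ g.1 = V.lift B := eq_lift (by
      rw [← Category.assoc, V.comp_lift, g.2.2])
    exact congrArg (fun σ : Spec (CommRingCat.of V.1) ⟶ B.Y ↦ σ (closedPoint V.1)) this⟩

lemma exists_finset_forall_map_mem {S : Type*} [CommRing S] {α : R →+* S} (hα : α.FiniteType)
    {χ : S →+* K} (h : χ.comp α = φ) :
    ∃ s : Finset S, ∀ V : ZR R K φ, (∀ a ∈ s, χ a ∈ V.1) → ∀ a, χ a ∈ V.1 := by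
  algebraize [α]
  obtain ⟨s, hs⟩ := Algebra.FiniteType.out (R := R) (A := S)
  refine ⟨s, fun V hV a ↦ ?_⟩
  let T : Subalgebra R S :=
    { V.1.toSubring.comap χ with
      algebraMap_mem' := fun r ↦ by
        change (χ.comp α) r ∈ V.1
        rw [h]
        exact V.2 r }
  have hT : Algebra.adjoin R s ≤ T := Algebra.adjoin_le hV
  rw [hs] at hT
  exact hT (Algebra.mem_top (x := a))

lemma exists_finset_forall_center_mem {U : Set A.Y} (hU : IsOpen U) (hV : V.center.1 A ∈ U) :
    ∃ s : Finset K, (∀ a ∈ s, a ∈ V.1) ∧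
      ∀ V' : ZR R K φ, (∀ a ∈ s, a ∈ V'.1) → V'.center.1 A ∈ U := by
  classical
  obtain ⟨W, hW, hx, hWU⟩ := exists_isAffineOpen_mem_and_subset (U := ⟨U, hU⟩) hV
  have := A.proper
  let α : CommRingCat.of R ⟶ Γ(A.Y, W) := (Scheme.ΓSpecIso _).inv ≫ A.f.appLE ⊤ W le_top
  have hα : Spec.map α = hW.fromSpec ≫ A.f := by
    rw [← IsAffineOpen.SpecMap_appLE_fromSpec A.f (isAffineOpen_top _) hW le_top, Spec.map_comp,
      IsAffineOpen.fromSpec_top, Scheme.isoSpec_Spec_inv]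
  have hfin : α.hom.FiniteType :=
    (A.f.finiteType_appLE (isAffineOpen_top _) hW le_top).comp (.of_surjective _
      ((ConcreteCategory.isIso_iff_bijective (Scheme.ΓSpecIso _).inv).1 inferInstance).2)
  obtain ⟨χ₀, hχ₀⟩ := exists_SpecMap_comp_fromSpec (V.lift A) hW hx
  let χ := χ₀ ≫ CommRingCat.ofHom V.1.subtype
  have hχ : Spec.map χ ≫ hW.fromSpec = A.ι := by
    rw [Spec.map_comp, Category.assoc, hχ₀, V.comp_lift]
  have hαχ : α ≫ χ = CommRingCat.ofHom φ := Spec.map_injective (by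
    rw [Spec.map_comp, hα, ← Category.assoc, hχ, A.fac])
  obtain ⟨s, hs⟩ := exists_finset_forall_map_mem (χ := χ.hom) hfin
    (congrArg CommRingCat.Hom.hom hαχ)
  refine ⟨s.image χ.hom, ?_, fun V' hV' ↦ hWU ?_⟩
  · intro a ha
    obtain ⟨b, -, rfl⟩ := Finset.mem_image.1 ha
    exact (χ₀.hom b).2
  · let θ : Γ(A.Y, W) ⟶ CommRingCat.of V'.1 := CommRingCat.ofHom
      (χ.hom.codRestrict V'.1.toSubring
        (hs V' fun a ha ↦ hV' _ (Finset.mem_image_of_mem _ ha)))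
    have hθ : Spec.map θ ≫ hW.fromSpec = V'.lift A := eq_lift (by
      rw [← Category.assoc, ← Spec.map_comp]
      exact hχ)
    change V'.lift A _ ∈ (W : Set A.Y)
    rw [← hθ, ← hW.range_fromSpec]
    exact ⟨_, rfl⟩

lemma continuous_center : Continuous (center : ZR R K φ → InvLim R K φ) := by
  refine Continuous.subtype_mk (continuous_pi fun A ↦ ?_) _
  refine continuous_def.2 fun U hU ↦ isOpen_iff_forall_mem_open.2 fun V hV ↦ ?_
  obtain ⟨s, hs, h⟩ := V.exists_finset_forall_center_mem A hU hV
  refine ⟨⋂ a ∈ s, {V | a ∈ V.1}, fun V' hV' ↦ h V' (by simpa using hV'), ?_, by simpa using hs⟩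
  exact isOpen_biInter_finset fun a _ ↦ .basic _ ⟨a, rfl⟩

lemma toZR_center : V.center.toZR = V := by
  refine Subtype.ext (SetLike.ext fun a ↦ ?_)
  have key {A : Model R K φ} {a : K} (ha : a ∈ localRange A.ι (V.center.1 A)) :=
    localRange_closedPoint V.1 (V.comp_lift A) ha
  refine V.center.mem_toValuationSubring.trans ⟨fun ⟨A, ha⟩ ↦ (key ha).1, fun ha ↦ ?_⟩
  rcases eq_or_ne a 0 with rfl | h0
  · exact V.center.toValuationSubring.zero_mem
  obtain ⟨A, hA⟩ := Model.exists_mem_or_inv_mem (φ := φ) h0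
  refine ⟨A, (hA _).elim id fun h ↦ ?_⟩
  have := (key h).2 (inv_ne_zero h0) (by rwa [inv_inv])
  rwa [inv_inv] at this

end ZR

lemma InvLim.center_toZR (p : InvLim R K φ) : p.toZR.center = p := by
  refine Subtype.ext (funext fun A ↦ ?_)
  obtain ⟨σ, hσ, h⟩ := p.exists_lift A
  rw [← h, ZR.eq_lift hσ]
  rfl

/-- The homeomorphism sending a valuation ring to its family of centers. -/
noncomputable def ZR.homeomorphInvLim : ZR R K φ ≃ₜ InvLim R K φ where
  toFun := ZR.center
  invFun := InvLim.toZR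
  left_inv := ZR.toZR_center
  right_inv := InvLim.center_toZR
  continuous_toFun := ZR.continuous_center
  continuous_invFun := InvLim.continuous_toZR

end InverseLimit

variable (R K φ)

/-- The Zariski–Riemann space `ZR(K/R)` is homeomorphic to the inverse limit of the
underlying spaces of the reduced proper models of `Spec K ⟶ Spec R`, via the map sending a
valuation subring `V` to the family of images of the closed point of `Spec V` under the
unique morphisms `σ_V : Spec V ⟶ Y` (over `Spec R`, restricting to `ι` along
`Spec K ⟶ Spec V`) provided by the valuative criterion of properness. -/
theorem zariskiRiemann_homeomorph_invLim :
    ∃ h : ZR R K φ ≃ₜ InvLim R K φ,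
      ∀ (V : ZR R K φ) (A : Model R K φ),
        (∃! σ : Spec (CommRingCat.of V.1) ⟶ A.Y,
            σ ≫ A.f = Spec.map (CommRingCat.ofHom (φ.codRestrict V.1.toSubring V.2)) ∧
            Spec.map (CommRingCat.ofHom V.1.subtype) ≫ σ = A.ι) ∧
        (∀ σ : Spec (CommRingCat.of V.1) ⟶ A.Y,
          σ ≫ A.f = Spec.map (CommRingCat.ofHom (φ.codRestrict V.1.toSubring V.2)) →
          Spec.map (CommRingCat.ofHom V.1.subtype) ≫ σ = A.ι →
          (h V).1 A = σ.base (IsLocalRing.closedPoint V.1)) := by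
  refine ⟨ZR.homeomorphInvLim, fun V A ↦ ⟨⟨V.lift A, ⟨V.comp_f_of_comp_eq A (V.comp_lift A),
    V.comp_lift A⟩, fun σ hσ ↦ ZR.eq_lift hσ.2⟩, fun σ _ hσ ↦ ?_⟩⟩
  rw [ZR.eq_lift hσ]
  rfl
end
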